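/- Let K and L be languages over a finite alphabet Σ accepted by an m-state alternating finite automaton and an n-state alternating finite automaton, respectively. Then the symmetric difference (K \ L) ∪ (L \ K) is accepted by an alternating finite automaton with at most m + n states. Moreover, for all m, n ≥ 2 there exist languages K and L over a one-letter alphabet accepted by an m-state and an n-state alternating finite automaton, respectively, such that every alternating finite automaton accepting their symmetric difference has at least m + n states. -/

import Mathlib

/-- A Boolean finite automaton (BFA): `δ` maps each state and symbol to a
Boolean function in the state variables, `g` is the initial Boolean function,
and `accept` is the finality (characteristic) vector of the final state set. -/
structure BFA (α : Type) (σ : Type) where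
  δ : σ → α → (σ → Bool) → Bool
  g : (σ → Bool) → Bool
  accept : σ → Bool

namespace BFA

variable {α σ : Type}

/-- One-symbol action on Boolean functions: `(h·a)(v) = h (fun q => δ q a v)`. -/
def stepFn (A : BFA α σ) (h : (σ → Bool) → Bool) (a : α) : (σ → Bool) → Bool :=
  fun v => h fun q => A.δ q a v

/-- Action of a string on the initial function: `g·ε = g`, `g·(wa) = (g·w)·a`. -/
def eval (A : BFA α σ) (w : List α) : (σ → Bool) → Bool :=
  w.foldl A.stepFn A.g

/-- The language of a BFA: strings whose resulting Boolean function
evaluates to `true` on the finality vector. -/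
def language (A : BFA α σ) : Language α :=
  { w | A.eval w A.accept = true }

/-- A BFA is alternating (an AFA) if its initial function is a projection. -/
def IsAFA (A : BFA α σ) : Prop :=
  ∃ q₀ : σ, A.g = fun v => v q₀

end BFA

/-- `L` is accepted by some `n`-state BFA. -/
def AcceptsBFA {α : Type} (L : Language α) (n : ℕ) : Prop :=
  ∃ (σ : Type) (_ : Fintype σ), Fintype.card σ = n ∧ ∃ A : BFA α σ, A.language = L

/-- `L` is accepted by some `n`-state AFA. -/
def AcceptsAFA {α : Type} (L : Language α) (n : ℕ) : Prop :=
  ∃ (σ : Type) (_ : Fintype σ), Fintype.card σ = n ∧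
    ∃ A : BFA α σ, A.IsAFA ∧ A.language = L

/-- `L` is accepted by some `n`-state DFA. -/
def AcceptsDFA {α : Type} (L : Language α) (n : ℕ) : Prop :=
  ∃ (σ : Type) (_ : Fintype σ), Fintype.card σ = n ∧ ∃ D : DFA α σ, D.accepts = L

/-- `L` is accepted by some `n`-state NFA with a unique initial state. -/
def AcceptsNFA1 {α : Type} (L : Language α) (n : ℕ) : Prop :=
  ∃ (σ : Type) (_ : Fintype σ), Fintype.card σ = n ∧
    ∃ (M : NFA α σ) (q₀ : σ), M.start = {q₀} ∧ M.accepts = L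

/-- The reversal of a language. -/
def Language.rev {α : Type} (L : Language α) : Language α :=
  { w | w.reverse ∈ L }

namespace BFA

variable {α σ : Type}

/-- The backward transition on valuations: reading `a` replaces `v` by `q ↦ δ q a v`. -/
def back (A : BFA α σ) (a : α) (v : σ → Bool) : σ → Bool :=
  fun q => A.δ q a v

theorem foldl_stepFn (A : BFA α σ) (w : List α) (h : (σ → Bool) → Bool) (v : σ → Bool) :
    w.foldl A.stepFn h v = h (w.foldr A.back v) := by
  induction w generalizing h with
  | nil => rfl
  | cons a w ih => exact ih _

theorem mem_language (A : BFA α σ) (w : List α) :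
    w ∈ A.language ↔ A.g (w.foldr A.back A.accept) = true := by
  rw [← foldl_stepFn A w A.g]
  rfl

end BFA

theorem mem_symmDiff_language {α : Type} (K L : Language α) (w : List α) :
    w ∈ (K \ L) ⊔ (L \ K) ↔ ¬(w ∈ K ↔ w ∈ L) := by
  change (w ∈ K ∧ w ∉ L) ∨ (w ∈ L ∧ w ∉ K) ↔ _
  tauto

/-- The involution of valuations of a disjoint union of states that adds the value at `inr q₀`
to the value at `inl p₀`. -/
noncomputable def xorTwist {σ τ : Type} (p₀ : σ) (q₀ : τ) (v : σ ⊕ τ → Bool) : σ ⊕ τ → Bool :=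
  open Classical in Function.update v (.inl p₀) (xor (v (.inl p₀)) (v (.inr q₀)))

theorem xorTwist_xorTwist {σ τ : Type} (p₀ : σ) (q₀ : τ) (v : σ ⊕ τ → Bool) :
    xorTwist p₀ q₀ (xorTwist p₀ q₀ v) = v := by
  simp [xorTwist]

theorem AcceptsAFA.symmDiff {α : Type} {K L : Language α} {m n : ℕ}
    (hK : AcceptsAFA K m) (hL : AcceptsAFA L n) :
    AcceptsAFA ((K \ L) ⊔ (L \ K)) (m + n) := by
  obtain ⟨σ, _, rfl, A, ⟨p₀, hp⟩, rfl⟩ := hK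
  obtain ⟨τ, _, rfl, B, ⟨q₀, hq⟩, rfl⟩ := hL
  let F : α → (σ ⊕ τ → Bool) → σ ⊕ τ → Bool := fun a v =>
    Sum.elim (A.back a (v ∘ .inl)) (B.back a (v ∘ .inr))
  let C : BFA α (σ ⊕ τ) :=
    { δ := fun q a v => xorTwist p₀ q₀ (F a (xorTwist p₀ q₀ v)) q
      g := fun v => v (.inl p₀)
      accept := xorTwist p₀ q₀ (Sum.elim A.accept B.accept) }
  refine ⟨σ ⊕ τ, inferInstance, Fintype.card_sum, C, ⟨.inl p₀, rfl⟩, ?_⟩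
  have run (w : List α) : w.foldr C.back C.accept = xorTwist p₀ q₀
      (Sum.elim (w.foldr A.back A.accept) (w.foldr B.back B.accept)) := by
    induction w with
    | nil => rfl
    | cons a w ih =>
      rw [List.foldr_cons, ih]
      change xorTwist p₀ q₀ (F a (xorTwist p₀ q₀ (xorTwist p₀ q₀ _))) = _
      rw [xorTwist_xorTwist]
      rfl
  ext w
  rw [mem_symmDiff_language, BFA.mem_language, BFA.mem_language, BFA.mem_language, run, hp, hq]
  simp only [C, xorTwist, Function.update_self, Sum.elim_inl, Sum.elim_inr]
  cases w.foldr A.back A.accept p₀ <;> cases w.foldr B.back B.accept q₀ <;> simp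

/-- The words whose length is less than `M` modulo `N`. -/
def lengthModLT (α : Type) (N M : ℕ) : Language α :=
  { w | w.length % N < M }

theorem acceptsAFA_lengthModLT (α : Type) {N k : ℕ} (hN : N ≤ 2 * 2 ^ k) (hpos : 0 < N) :
    AcceptsAFA (lengthModLT α N (2 ^ k)) (k + 1) := by
  have hM : 0 < 2 ^ k := by positivity
  let e : (Fin k → Bool) ≃ Fin (2 ^ k) := Fintype.equivFinOfCardEq (by simp)
  let enc : ℕ → Option (Fin k) → Bool := fun i q =>
    q.elim (decide (i % N < 2 ^ k)) (e.symm ⟨i % N % 2 ^ k, Nat.mod_lt _ hM⟩)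
  have enc_inj {i j : ℕ} (h : enc i = enc j) : i % N = j % N := by
    have h₁ : (i % N < 2 ^ k) ↔ (j % N < 2 ^ k) := by simpa [enc] using congrFun h none
    have h₂ : i % N % 2 ^ k = j % N % 2 ^ k := by
      have : e.symm ⟨i % N % 2 ^ k, Nat.mod_lt _ hM⟩ = e.symm ⟨j % N % 2 ^ k, Nat.mod_lt _ hM⟩ :=
        funext fun q => congrFun h (some q)
      simpa using this
    have hi := Nat.mod_lt i hpos
    have hj := Nat.mod_lt j hpos
    by_cases hc : i % N < 2 ^ k
    · rwa [Nat.mod_eq_of_lt hc, Nat.mod_eq_of_lt (h₁.1 hc)] at h₂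
    · have hd : ¬ j % N < 2 ^ k := fun h => hc (h₁.2 h)
      rw [Nat.mod_eq_sub_mod (not_lt.1 hc), Nat.mod_eq_sub_mod (not_lt.1 hd),
        Nat.mod_eq_of_lt (a := i % N - 2 ^ k) (by omega),
        Nat.mod_eq_of_lt (a := j % N - 2 ^ k) (by omega)] at h₂
      omega
  have enc_congr {i j : ℕ} (h : i % N = j % N) : enc i = enc j := by simp only [enc, h]
  let A : BFA α (Option (Fin k)) :=
    { δ := fun q _ v => enc (Function.invFun enc v + 1) q
      g := fun v => v none
      accept := enc 0 }
  refine ⟨Option (Fin k), inferInstance, by simp, A, ⟨none, rfl⟩, ?_⟩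
  have run (w : List α) : w.foldr A.back A.accept = enc w.length := by
    induction w with
    | nil => rfl
    | cons a w ih =>
      rw [List.foldr_cons, ih]
      exact enc_congr (Nat.ModEq.add_right 1 (enc_inj (Function.invFun_eq ⟨w.length, rfl⟩)))
  ext w
  rw [BFA.mem_language, run]
  exact decide_eq_true_iff

/-- A language accepted by a `k`-state BFA is ultimately periodic along powers of a letter, with
period at most `2 ^ k`. -/
theorem exists_period_of_acceptsAFA {α : Type} {L : Language α} {k : ℕ} (hL : AcceptsAFA L k)
    (a : α) : ∃ i d : ℕ, 0 < d ∧ d ≤ 2 ^ k ∧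
      ∀ r, i ≤ r → (List.replicate (r + d) a ∈ L ↔ List.replicate r a ∈ L) := by
  obtain ⟨σ, _, rfl, A, -, rfl⟩ := hL
  let x : ℕ → σ → Bool := fun i => (List.replicate i a).foldr A.back A.accept
  have x_succ (i : ℕ) : x (i + 1) = A.back a (x i) := by simp [x, List.replicate_succ]
  obtain ⟨i, j, hij, hj, hx⟩ : ∃ i j, i < j ∧ j ≤ 2 ^ Fintype.card σ ∧ x i = x j := by
    classical
    obtain ⟨i, j, hne, h⟩ := Fintype.exists_ne_map_eq_of_card_lt
      (fun i : Fin (2 ^ Fintype.card σ + 1) => x i) (by simp)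
    rcases lt_or_gt_of_ne hne with hlt | hlt
    · exact ⟨i, j, hlt, by omega, h⟩
    · exact ⟨j, i, hlt, by omega, h.symm⟩
  have shift (r : ℕ) : x (i + r) = x (j + r) := by
    induction r with
    | zero => exact hx
    | succ r ih => rw [← add_assoc, ← add_assoc, x_succ, x_succ, ih]
  refine ⟨i, j - i, by omega, by omega, fun r hr => ?_⟩
  rw [BFA.mem_language, BFA.mem_language]
  change A.g (x _) = true ↔ A.g (x _) = true
  have h := shift (r - i)
  rw [show i + (r - i) = r by omega, show j + (r - i) = r + (j - i) by omega] at h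
  rw [h]

theorem dvd_of_mod_lt_periodic {N M d : ℕ} (hM : 0 < M) (hMN : M < N)
    (h : ∀ i, (i + d) % N < M ↔ i % N < M) : N ∣ d := by
  by_contra hd
  have hlt := Nat.mod_lt d (hM.trans hMN)
  have hpos : 0 < d % N := Nat.pos_of_ne_zero fun h0 => hd (Nat.dvd_of_mod_eq_zero h0)
  have h₀ : d % N < M := by simpa [hM] using h 0
  have h₁ := h (M - d % N)
  rw [← Nat.add_mod_mod, Nat.sub_add_cancel h₀.le, Nat.mod_eq_of_lt hMN,
    Nat.mod_eq_of_lt (by omega)] at h₁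
  omega

/-- A period of the exclusive or of two sequences with coprime periods, one of them odd,
is a period of each of the sequences. -/
theorem periodic_of_xor_periodic {p q : ℕ → Prop} {N P d : ℕ} (hco : N.Coprime P) (hP : Odd P)
    (hp : ∀ i j, i ≡ j [MOD N] → (p i ↔ p j)) (hq : ∀ i j, i ≡ j [MOD P] → (q i ↔ q j))
    (h : ∀ i, (p (i + d) ↔ q (i + d)) ↔ (p i ↔ q i)) :
    (∀ i, p (i + d) ↔ p i) ∧ ∀ i, q (i + d) ↔ q i := by
  have key (i j : ℕ) : (p (i + d) ↔ p i) ↔ (q (j + d) ↔ q j) := by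
    obtain ⟨r, hr₁, hr₂⟩ := Nat.chineseRemainder hco i j
    have := h r
    have := hp _ _ hr₁
    have := hp _ _ (hr₁.add_right d)
    have := hq _ _ hr₂
    have := hq _ _ (hr₂.add_right d)
    tauto
  by_cases hc : q (0 + d) ↔ q 0
  · have h₁ (i : ℕ) : p (i + d) ↔ p i := (key i 0).2 hc
    exact ⟨h₁, fun j => (key 0 j).1 (h₁ 0)⟩
  · have flip (j : ℕ) : ¬(q (j + d) ↔ q j) := fun hj => hc ((key 0 0).1 ((key 0 j).2 hj))
    have alt (c : ℕ) : (q (c * d) ↔ q 0) ↔ Even c := by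
      induction c with
      | zero => simp
      | succ c ih =>
        have := flip (c * d)
        rw [Nat.even_add_one, Nat.succ_mul]
        tauto
    exact absurd ((alt P).1 (hq _ _ (by simp [Nat.ModEq]))) (Nat.not_even_iff_odd.2 hP)

theorem mul_le_of_acceptsAFA_symmDiff_lengthModLT {α : Type} [Nonempty α] {N P M M' k : ℕ}
    (hco : N.Coprime P) (hP : Odd P) (hM : 0 < M) (hMN : M < N) (hM' : 0 < M') (hMP : M' < P)
    (h : AcceptsAFA ((lengthModLT α N M \ lengthModLT α P M') ⊔
      (lengthModLT α P M' \ lengthModLT α N M)) k) : N * P ≤ 2 ^ k := by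
  obtain ⟨a⟩ := ‹Nonempty α›
  obtain ⟨i, d, hd, hdk, hper⟩ := exists_period_of_acceptsAFA h a
  have hmem (N M r : ℕ) : List.replicate r a ∈ lengthModLT α N M ↔ r % N < M := by
    change (List.replicate r a).length % N < M ↔ _
    rw [List.length_replicate]
  simp only [mem_symmDiff_language, hmem, not_iff_not] at hper
  have hper' (r : ℕ) : ((r + d) % N < M ↔ (r + d) % P < M') ↔ (r % N < M ↔ r % P < M') := by
    have hpos : 1 ≤ N * P := Nat.mul_pos (by omega) (by omega)
    have hr := hper (r + N * P * i) (le_add_left (Nat.le_mul_of_pos_left i hpos))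
    rw [add_right_comm] at hr
    have hNP (s : ℕ) : (s + N * P * i) % N = s % N := by
      rw [mul_assoc, Nat.add_mul_mod_self_left]
    have hPN (s : ℕ) : (s + N * P * i) % P = s % P := by
      rw [mul_comm N P, mul_assoc, Nat.add_mul_mod_self_left]
    simpa only [hNP, hPN] using hr
  obtain ⟨h₁, h₂⟩ := periodic_of_xor_periodic (p := fun r => r % N < M)
    (q := fun r => r % P < M') hco hP
    (fun i j hij => by rw [show i % N = j % N from hij])
    (fun i j hij => by rw [show i % P = j % P from hij]) hper'
  have hdvd := hco.mul_dvd_of_dvd_of_dvd (dvd_of_mod_lt_periodic hM hMN h₁)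
    (dvd_of_mod_lt_periodic hM' hMP h₂)
  exact (Nat.le_of_dvd hd hdvd).trans hdk

/-- Symmetric difference on AFAs: the upper bound `m + n` holds, and it is
tight over a unary alphabet for all `m, n ≥ 2`. (For languages, `⊔` is union.) -/
theorem afa_symmdiff_tight :
    (∀ (α : Type) [Fintype α] (K L : Language α) (m n : ℕ),
      AcceptsAFA K m → AcceptsAFA L n →
        ∃ k ≤ m + n, AcceptsAFA ((K \ L) ⊔ (L \ K)) k) ∧
    ∀ m n : ℕ, 2 ≤ m → 2 ≤ n → ∃ K L : Language (Fin 1),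
      AcceptsAFA K m ∧ AcceptsAFA L n ∧
      ∀ k : ℕ, AcceptsAFA ((K \ L) ⊔ (L \ K)) k → m + n ≤ k := by
  refine ⟨fun α _ K L m n hK hL => ⟨m + n, le_rfl, hK.symmDiff hL⟩, fun m n hm hn => ?_⟩
  obtain ⟨m, rfl⟩ : ∃ m', m = m' + 1 := ⟨m - 1, by omega⟩
  obtain ⟨n, rfl⟩ : ∃ n', n = n' + 1 := ⟨n - 1, by omega⟩
  have hn2 : 2 ≤ 2 ^ n := Nat.le_self_pow (n := n) (by omega) 2
  have hm1 : 0 < 2 ^ m := by positivity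
  have hP : Odd (2 * 2 ^ n - 1) := ⟨2 ^ n - 1, by omega⟩
  have hco : (2 * 2 ^ m).Coprime (2 * 2 ^ n - 1) := by
    rw [← pow_succ']
    exact hP.coprime_two_left.pow_left _
  refine ⟨lengthModLT _ (2 * 2 ^ m) (2 ^ m), lengthModLT _ (2 * 2 ^ n - 1) (2 ^ n),
    acceptsAFA_lengthModLT _ le_rfl (by omega),
    acceptsAFA_lengthModLT _ (Nat.sub_le _ _) (by omega), fun k hk => ?_⟩
  have hle := mul_le_of_acceptsAFA_symmDiff_lengthModLT hco hP hm1 (by omega) (by omega)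
    (by omega) hk
  have hlt : 2 ^ (m + 1 + n) < 2 ^ k := calc
    2 ^ (m + 1 + n) = 2 * 2 ^ m * 2 ^ n := by ring
    _ < 2 * 2 ^ m * (2 * 2 ^ n - 1) := Nat.mul_lt_mul_of_pos_left (by omega) (by omega)
    _ ≤ 2 ^ k := hle
  have := (Nat.pow_lt_pow_iff_right (by norm_num)).1 hlt
  omega
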